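/- Let L₁, L₂ > 0, c > 0, λ ≥ 0, D > 0 and p_out be real numbers. For i = 1,2 let ρᵢ, mᵢ : ℝ × ℝ → ℝ be continuously differentiable with ρᵢ(x,t) > 0 on [0,Lᵢ], satisfying the ISO2b equations ∂ₜρᵢ + ∂ₓmᵢ = 0 and ∂ₜmᵢ + ∂ₓ(c²ρᵢ) = −(λ/(2D))·mᵢ·|mᵢ/ρᵢ| for all x ∈ [0,Lᵢ] and all t. Assume the FP/AM compressor coupling conditions hold for all t: c²ρ₂(0,t) = p_out and m₁(L₁,t) = m₂(0,t). Let H(t) = ∫₀^{L₁} (c²ρ₁²/2 + m₁²/2) dx + ∫₀^{L₂} (c²ρ₂²/2 + m₂²/2) dx. Then for every t, H'(t) = c²ρ₁(0,t)·m₁(0,t) − c²ρ₂(L₂,t)·m₂(L₂,t) + (p_out − c²ρ₁(L₁,t))·m₂(0,t) − ∫₀^{L₁} (λ/(2D))·|m₁/ρ₁|·m₁² dx − ∫₀^{L₂} (λ/(2D))·|m₂/ρ₂|·m₂² dx. In particular, if p_out = c²ρ₁(L₁,t) for all t, the compressor adds no energy. -/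

import Mathlib

open intervalIntegral

theorem hasDerivAt_snd_of_contDiff {f : ℝ × ℝ → ℝ} (hf : ContDiff ℝ 1 f) (x t : ℝ) :
    HasDerivAt (fun τ => f (x, τ)) (fderiv ℝ f (x, t) (0, 1)) t :=
  ((hf.differentiable one_ne_zero) (x, t)).hasFDerivAt.comp_hasDerivAt t
    ((hasDerivAt_const t x).prodMk (hasDerivAt_id t))

theorem hasDerivAt_fst_of_contDiff {f : ℝ × ℝ → ℝ} (hf : ContDiff ℝ 1 f) (x t : ℝ) :
    HasDerivAt (fun ξ => f (ξ, t)) (fderiv ℝ f (x, t) (1, 0)) x :=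
  ((hf.differentiable one_ne_zero) (x, t)).hasFDerivAt.comp_hasDerivAt x
    ((hasDerivAt_id x).prodMk (hasDerivAt_const x t))

theorem continuous_fderiv_apply_const {f : ℝ × ℝ → ℝ} (hf : ContDiff ℝ 1 f) (v : ℝ × ℝ) :
    Continuous fun p => fderiv ℝ f p v :=
  (hf.continuous_fderiv one_ne_zero).clm_apply continuous_const

/-- Leibniz rule for a continuously differentiable integrand on a fixed interval. -/
theorem hasDerivAt_integral_of_contDiff {f : ℝ × ℝ → ℝ} (hf : ContDiff ℝ 1 f) (a b t : ℝ) :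
    HasDerivAt (fun τ => ∫ x in a..b, f (x, τ))
      (∫ x in a..b, fderiv ℝ f (x, t) (0, 1)) t := by
  have hdf := continuous_fderiv_apply_const hf (0, 1)
  obtain ⟨C, hC⟩ := ((isCompact_uIcc (a := a) (b := b)).prod
    (isCompact_closedBall t (1 : ℝ))).exists_bound_of_continuousOn hdf.continuousOn
  have hfc := hf.continuous
  refine (intervalIntegral.hasDerivAt_integral_of_dominated_loc_of_deriv_le
    (F := fun τ x => f (x, τ)) (F' := fun τ x => fderiv ℝ f (x, τ) (0, 1))
    (bound := fun _ => C) (Metric.closedBall_mem_nhds t one_pos) ?_ ?_ ?_ ?_ ?_ ?_).2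
  · refine Filter.Eventually.of_forall fun τ => Continuous.aestronglyMeasurable ?_
    fun_prop
  · exact Continuous.intervalIntegrable (by fun_prop) a b
  · exact (hdf.comp (Continuous.prodMk_left t)).aestronglyMeasurable
  · exact Filter.Eventually.of_forall fun x hx τ hτ =>
      hC (x, τ) ⟨Set.uIoc_subset_uIcc hx, hτ⟩
  · exact intervalIntegrable_const
  · exact Filter.Eventually.of_forall fun x _ τ _ => hasDerivAt_snd_of_contDiff hf x τ

/-- Energy balance of a single ISO2b pipe. -/
theorem hasDerivAt_pipe_energy {L c lam D : ℝ} (hL : 0 ≤ L) {ρ m : ℝ × ℝ → ℝ}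
    (hρ : ContDiff ℝ 1 ρ) (hm : ContDiff ℝ 1 m)
    (hpos : ∀ x ∈ Set.Icc (0 : ℝ) L, ∀ t : ℝ, 0 < ρ (x, t))
    (hmass : ∀ x ∈ Set.Icc (0 : ℝ) L, ∀ t : ℝ,
      deriv (fun τ => ρ (x, τ)) t + deriv (fun ξ => m (ξ, t)) x = 0)
    (hmom : ∀ x ∈ Set.Icc (0 : ℝ) L, ∀ t : ℝ,
      deriv (fun τ => m (x, τ)) t + deriv (fun ξ => c ^ 2 * ρ (ξ, t)) x =
        -(lam / (2 * D)) * m (x, t) * |m (x, t) / ρ (x, t)|) (t : ℝ) :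
    HasDerivAt (fun t => ∫ x in (0 : ℝ)..L, (c ^ 2 * ρ (x, t) ^ 2 / 2 + m (x, t) ^ 2 / 2))
      (c ^ 2 * ρ (0, t) * m (0, t) - c ^ 2 * ρ (L, t) * m (L, t)
        - ∫ x in (0 : ℝ)..L, lam / (2 * D) * |m (x, t) / ρ (x, t)| * m (x, t) ^ 2) t := by
  have hE : ContDiff ℝ 1 fun p => c ^ 2 * ρ p ^ 2 / 2 + m p ^ 2 / 2 := by fun_prop
  have hF : ContDiff ℝ 1 fun p => c ^ 2 * ρ p * m p := by fun_prop
  have hflux_int : IntervalIntegrable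
      (fun x => fderiv ℝ (fun p => c ^ 2 * ρ p * m p) (x, t) (1, 0))
      MeasureTheory.volume 0 L :=
    ((continuous_fderiv_apply_const hF (1, 0)).comp
      (Continuous.prodMk_left t)).intervalIntegrable 0 L
  have hflux := intervalIntegral.integral_eq_sub_of_hasDerivAt
    (fun x _ => hasDerivAt_fst_of_contDiff hF x t) hflux_int
  have hfric : IntervalIntegrable
      (fun x => lam / (2 * D) * |m (x, t) / ρ (x, t)| * m (x, t) ^ 2)
      MeasureTheory.volume 0 L := by
    apply ContinuousOn.intervalIntegrable
    rw [Set.uIcc_of_le hL]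
    have hmc : Continuous fun x => m (x, t) := hm.continuous.comp (Continuous.prodMk_left t)
    have hρc : Continuous fun x => ρ (x, t) := hρ.continuous.comp (Continuous.prodMk_left t)
    exact (continuousOn_const.mul
      (hmc.continuousOn.div hρc.continuousOn fun x hx => (hpos x hx t).ne').abs).mul
      (hmc.pow 2).continuousOn
  have hlocal : ∀ x ∈ Set.uIcc 0 L,
      fderiv ℝ (fun p => c ^ 2 * ρ p ^ 2 / 2 + m p ^ 2 / 2) (x, t) (0, 1) =
        -fderiv ℝ (fun p => c ^ 2 * ρ p * m p) (x, t) (1, 0)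
          - lam / (2 * D) * |m (x, t) / ρ (x, t)| * m (x, t) ^ 2 := by
    intro x hx
    rw [Set.uIcc_of_le hL] at hx
    have hρt := hasDerivAt_snd_of_contDiff hρ x t
    have hmt := hasDerivAt_snd_of_contDiff hm x t
    have hρx := hasDerivAt_fst_of_contDiff hρ x t
    have hmx := hasDerivAt_fst_of_contDiff hm x t
    have h₁ := hmass x hx t
    have h₂ := hmom x hx t
    rw [hρt.deriv, hmx.deriv] at h₁
    rw [hmt.deriv, (hρx.const_mul (c ^ 2)).deriv] at h₂
    rw [(hasDerivAt_snd_of_contDiff hE x t).unique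
        ((((hρt.pow 2).const_mul (c ^ 2)).div_const 2).add ((hmt.pow 2).div_const 2)),
      (hasDerivAt_fst_of_contDiff hF x t).unique ((hρx.const_mul (c ^ 2)).mul hmx)]
    push_cast
    linear_combination c ^ 2 * ρ (x, t) * h₁ + m (x, t) * h₂
  convert hasDerivAt_integral_of_contDiff hE 0 L t using 1
  have hneg_int : IntervalIntegrable
      (fun x => -fderiv ℝ (fun p => c ^ 2 * ρ p * m p) (x, t) (1, 0))
      MeasureTheory.volume 0 L := hflux_int.neg
  rw [intervalIntegral.integral_congr hlocal,
    intervalIntegral.integral_sub hneg_int hfric, intervalIntegral.integral_neg, hflux]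
  ring

/-- Energy balance for two ISO2b pipes coupled by a compressor in
framework FP (prescribed output pressure `pout`) under assumption AM
(constant momentum across the compressor). In particular, when the
prescribed output pressure matches the pipe-1 outlet pressure, the
compressor adds no energy. -/
theorem fp_am_two_pipe_energy_balance
    (L₁ L₂ c lam D : ℝ) (hL₁ : 0 < L₁) (hL₂ : 0 < L₂) (hc : 0 < c)
    (hlam : 0 ≤ lam) (hD : 0 < D) (pout : ℝ)
    (ρ₁ m₁ ρ₂ m₂ : ℝ × ℝ → ℝ)
    (hρ₁ : ContDiff ℝ 1 ρ₁) (hm₁ : ContDiff ℝ 1 m₁)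
    (hρ₂ : ContDiff ℝ 1 ρ₂) (hm₂ : ContDiff ℝ 1 m₂)
    (hρ₁pos : ∀ x ∈ Set.Icc (0 : ℝ) L₁, ∀ t : ℝ, 0 < ρ₁ (x, t))
    (hρ₂pos : ∀ x ∈ Set.Icc (0 : ℝ) L₂, ∀ t : ℝ, 0 < ρ₂ (x, t))
    (hmass₁ : ∀ x ∈ Set.Icc (0 : ℝ) L₁, ∀ t : ℝ,
      deriv (fun τ => ρ₁ (x, τ)) t + deriv (fun ξ => m₁ (ξ, t)) x = 0)
    (hmom₁ : ∀ x ∈ Set.Icc (0 : ℝ) L₁, ∀ t : ℝ,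
      deriv (fun τ => m₁ (x, τ)) t + deriv (fun ξ => c ^ 2 * ρ₁ (ξ, t)) x =
        -(lam / (2 * D)) * m₁ (x, t) * |m₁ (x, t) / ρ₁ (x, t)|)
    (hmass₂ : ∀ x ∈ Set.Icc (0 : ℝ) L₂, ∀ t : ℝ,
      deriv (fun τ => ρ₂ (x, τ)) t + deriv (fun ξ => m₂ (ξ, t)) x = 0)
    (hmom₂ : ∀ x ∈ Set.Icc (0 : ℝ) L₂, ∀ t : ℝ,
      deriv (fun τ => m₂ (x, τ)) t + deriv (fun ξ => c ^ 2 * ρ₂ (ξ, t)) x =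
        -(lam / (2 * D)) * m₂ (x, t) * |m₂ (x, t) / ρ₂ (x, t)|)
    (hpressure : ∀ t : ℝ, c ^ 2 * ρ₂ (0, t) = pout)
    (hmomentum : ∀ t : ℝ, m₁ (L₁, t) = m₂ (0, t))
    (H : ℝ → ℝ)
    (hH : ∀ t : ℝ, H t =
      (∫ x in (0 : ℝ)..L₁, (c ^ 2 * ρ₁ (x, t) ^ 2 / 2 + m₁ (x, t) ^ 2 / 2)) +
      ∫ x in (0 : ℝ)..L₂, (c ^ 2 * ρ₂ (x, t) ^ 2 / 2 + m₂ (x, t) ^ 2 / 2)) :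
    ∀ t : ℝ, HasDerivAt H
      (c ^ 2 * ρ₁ (0, t) * m₁ (0, t) - c ^ 2 * ρ₂ (L₂, t) * m₂ (L₂, t)
        + (pout - c ^ 2 * ρ₁ (L₁, t)) * m₂ (0, t)
        - (∫ x in (0 : ℝ)..L₁,
            lam / (2 * D) * |m₁ (x, t) / ρ₁ (x, t)| * m₁ (x, t) ^ 2)
        - ∫ x in (0 : ℝ)..L₂,
            lam / (2 * D) * |m₂ (x, t) / ρ₂ (x, t)| * m₂ (x, t) ^ 2) t ∧
    ((∀ t : ℝ, pout = c ^ 2 * ρ₁ (L₁, t)) →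
      ∀ t : ℝ, HasDerivAt H
        (c ^ 2 * ρ₁ (0, t) * m₁ (0, t) - c ^ 2 * ρ₂ (L₂, t) * m₂ (L₂, t)
          - (∫ x in (0 : ℝ)..L₁,
              lam / (2 * D) * |m₁ (x, t) / ρ₁ (x, t)| * m₁ (x, t) ^ 2)
          - ∫ x in (0 : ℝ)..L₂,
              lam / (2 * D) * |m₂ (x, t) / ρ₂ (x, t)| * m₂ (x, t) ^ 2) t) := by
  have balance : ∀ t : ℝ, HasDerivAt H
      (c ^ 2 * ρ₁ (0, t) * m₁ (0, t) - c ^ 2 * ρ₂ (L₂, t) * m₂ (L₂, t)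
        + (pout - c ^ 2 * ρ₁ (L₁, t)) * m₂ (0, t)
        - (∫ x in (0 : ℝ)..L₁,
            lam / (2 * D) * |m₁ (x, t) / ρ₁ (x, t)| * m₁ (x, t) ^ 2)
        - ∫ x in (0 : ℝ)..L₂,
            lam / (2 * D) * |m₂ (x, t) / ρ₂ (x, t)| * m₂ (x, t) ^ 2) t := by
    intro t
    rw [funext hH]
    refine ((hasDerivAt_pipe_energy hL₁.le hρ₁ hm₁ hρ₁pos hmass₁ hmom₁ t).add
      (hasDerivAt_pipe_energy hL₂.le hρ₂ hm₂ hρ₂pos hmass₂ hmom₂ t)).congr_deriv ?_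
    rw [hpressure t, hmomentum t]
    ring
  refine fun t => ⟨balance t, fun hp s => ?_⟩
  simpa [← hp s] using balance s
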